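/- There exists a constant C_Γ > 0, depending only on the Schottky data, such that for every nonempty word 𝐚 ∈ W°: C_Γ^{-1} |I_𝐚|^δ ≤ μ(I_𝐚) ≤ C_Γ |I_𝐚|^δ. -/

import Mathlib

open MeasureTheory Set Real Pointwise

noncomputable section

abbrev SL2 := Matrix.SpecialLinearGroup (Fin 2) ℝ

/-- The Möbius transformation of `ℝ` associated to `g ∈ SL(2,ℝ)` (junk value at the pole). -/
def mobius (g : SL2) (x : ℝ) : ℝ :=
  (g 0 0 * x + g 0 1) / (g 1 0 * x + g 1 1)

/-- The derivative `γ'(x) = (cx+d)⁻²` of the Möbius transformation. -/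
def mobiusDeriv (g : SL2) (x : ℝ) : ℝ :=
  ((g 1 0 * x + g 1 1) ^ 2)⁻¹

/-- The derivative of the Möbius transformation in the ball model,
`|γ'(x)|_B = ((1+x²)/(1+γ(x)²)) γ'(x)`. -/
def mobiusDerivB (g : SL2) (x : ℝ) : ℝ :=
  ((1 + x ^ 2) / (1 + mobius g x ^ 2)) * mobiusDeriv g x

/-- The Möbius action of `SL(2,ℝ)` on `ℝ ∪ {∞}`. -/
def mobiusOP (g : SL2) (x : OnePoint ℝ) : OnePoint ℝ :=
  Option.elim x
    (if g 1 0 = 0 then OnePoint.infty else ((g 0 0 / g 1 0 : ℝ) : OnePoint ℝ))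
    (fun y => if g 1 0 * y + g 1 1 = 0 then OnePoint.infty
      else ((mobius g y : ℝ) : OnePoint ℝ))

/-- The pole `γ⁻¹(∞) = -d/c` of `γ = [[a,b],[c,d]]`. -/
def mobiusPole (g : SL2) : ℝ := -(g 1 1) / (g 1 0)

/-- The distortion factor `α(γ, [x₀,x₁]) = log((γ⁻¹(∞) − x₁)/(γ⁻¹(∞) − x₀))`,
with the convention `α = 0` when `γ⁻¹(∞) = ∞` (i.e. `c = 0`). -/
def alphaDist (g : SL2) (x₀ x₁ : ℝ) : ℝ :=
  if g 1 0 = 0 then 0 else Real.log ((mobiusPole g - x₁) / (mobiusPole g - x₀))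

/-- The letter `ā` paired with `a` in the alphabet `{1,…,2r}` (modelled by `Fin (2r)`). -/
def bar {r : ℕ} (a : Fin (2 * r)) : Fin (2 * r) :=
  if h : (a : ℕ) < r then ⟨(a : ℕ) + r, by omega⟩
  else ⟨(a : ℕ) - r, by have := a.isLt; omega⟩

/-- Schottky data: `2r` disjoint compact intervals `I_a = [ξ₀ a, ξ₁ a]` on the real line and
transformations `γ_a ∈ SL(2,ℝ)` with `γ_ā = γ_a⁻¹` such that `γ_a` maps the complement (in
`ℝ ∪ {∞}`) of the interior of `I_ā` onto `I_a`. -/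
structure SchottkyData (r : ℕ) where
  hr : 2 ≤ r
  ξ₀ : Fin (2 * r) → ℝ
  ξ₁ : Fin (2 * r) → ℝ
  hlt : ∀ a, ξ₀ a < ξ₁ a
  hdisj : ∀ a b, a ≠ b → Disjoint (Icc (ξ₀ a) (ξ₁ a)) (Icc (ξ₀ b) (ξ₁ b))
  γ : Fin (2 * r) → SL2
  hinv : ∀ a, γ (bar a) = (γ a)⁻¹
  hmap : ∀ a, mobiusOP (γ a) ''
      (univ \ ((fun t : ℝ => (t : OnePoint ℝ)) '' Ioo (ξ₀ (bar a)) (ξ₁ (bar a))))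
      = (fun t : ℝ => (t : OnePoint ℝ)) '' Icc (ξ₀ a) (ξ₁ a)

namespace SchottkyData

variable {r : ℕ}

/-- `l` is a word: no letter is followed by its bar. -/
def IsWord (_ : SchottkyData r) (l : List (Fin (2 * r))) : Prop :=
  l.Chain' fun p q => q ≠ bar p

/-- The group element `γ_𝐚 = γ_{a_1} ⋯ γ_{a_n}` of a word. -/
def wordγ (S : SchottkyData r) (l : List (Fin (2 * r))) : SL2 :=
  (l.map S.γ).prod

/-- The interval `I_𝐚 = γ_{𝐚'}(I_{a_n})` of a nonempty word (and `∅` for the empty word). -/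
def wordI (S : SchottkyData r) (l : List (Fin (2 * r))) : Set ℝ :=
  if h : l = [] then ∅
  else mobius (S.wordγ l.dropLast) '' Icc (S.ξ₀ (l.getLast h)) (S.ξ₁ (l.getLast h))

/-- The limit set `Λ_Γ = ⋂_n ⋃_{𝐚 ∈ W_n} I_𝐚`. -/
def limitSet (S : SchottkyData r) : Set ℝ :=
  ⋂ n : ℕ, ⋃ (l : List (Fin (2 * r))) (_ : S.IsWord l ∧ l.length = n + 1), S.wordI l

/-- `μ` is the (δ-conformal) Patterson–Sullivan measure: a Borel probability measure
supported on the limit set satisfying the equivariance property under the group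
generated by the Schottky transformations. -/
def IsPS (S : SchottkyData r) (δ : ℝ) (μ : Measure ℝ) : Prop :=
  IsProbabilityMeasure μ ∧ μ S.limitSetᶜ = 0 ∧
    ∀ g ∈ Subgroup.closure (Set.range S.γ), ∀ f : ℝ → ℝ, Measurable f →
      (∃ C, ∀ x, |f x| ≤ C) →
      ∫ x, f x ∂μ = ∫ x, f (mobius g x) * mobiusDerivB g x ^ δ ∂μ

/-- The partition `Z(τ) = {𝐚 ∈ W° : |I_𝐚| ≤ τ < |I_{𝐚'}|}` (with `|I_∅| = ∞`). -/
def Zpart (S : SchottkyData r) (τ : ℝ) : Set (List (Fin (2 * r))) :=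
  {l | S.IsWord l ∧ l ≠ [] ∧ (MeasureTheory.volume (S.wordI l)).toReal ≤ τ ∧
    (l.dropLast = [] ∨ τ < (MeasureTheory.volume (S.wordI l.dropLast)).toReal)}

end SchottkyData

/-- The length `|I|` of an interval `I ⊂ ℝ`. -/
def ivlen (I : Set ℝ) : ℝ := (MeasureTheory.volume I).toReal

/-- `𝐚 ⇝ 𝐛` : the last letter of `𝐚` equals the first letter of `𝐛`. -/
def chn {X : Type*} (l m : List X) : Prop :=
  ∃ (h1 : l ≠ []) (h2 : m ≠ []), l.getLast h1 = m.head h2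

/-- The center of an interval. -/
def ctr (I : Set ℝ) : ℝ := (sInf I + sSup I) / 2

end

noncomputable section

open MeasureTheory Set Real

theorem exists_pos_le_all {ι : Type*} [Finite ι] (f : ι → ℝ) (hf : ∀ i, 0 < f i) :
    ∃ e > 0, ∀ i, e ≤ f i := by
  cases isEmpty_or_nonempty ι
  · exact ⟨1, one_pos, fun i => isEmptyElim i⟩
  · obtain ⟨i, hi⟩ := Finite.exists_min f
    exact ⟨f i, hf i, hi⟩

theorem mobiusOP_eq_smul (g : SL2) (x : OnePoint ℝ) :
    mobiusOP g x = (g : GL (Fin 2) ℝ) • x := by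
  induction x using OnePoint.rec with
  | infty =>
    rw [OnePoint.smul_infty_eq_ite]; rfl
  | coe y =>
    rw [OnePoint.smul_some_eq_ite]; rfl

theorem mobiusOP_mul (g h : SL2) (x : OnePoint ℝ) :
    mobiusOP (g * h) x = mobiusOP g (mobiusOP h x) := by
  simp only [mobiusOP_eq_smul, map_mul, mul_smul]

theorem mobiusOP_infty (g : SL2) : mobiusOP g OnePoint.infty =
    if g 1 0 = 0 then OnePoint.infty else ((g 0 0 / g 1 0 : ℝ) : OnePoint ℝ) := rfl

theorem mobiusOP_coe (g : SL2) (y : ℝ) : mobiusOP g (y : OnePoint ℝ) =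
    if g 1 0 * y + g 1 1 = 0 then OnePoint.infty
      else ((mobius g y : ℝ) : OnePoint ℝ) := rfl

theorem det_eq (g : SL2) : g 0 0 * g 1 1 - g 0 1 * g 1 0 = 1 := by
  have := g.det_coe
  rwa [Matrix.det_fin_two] at this

theorem mobius_sub (g : SL2) (x y : ℝ) (hx : g 1 0 * x + g 1 1 ≠ 0)
    (hy : g 1 0 * y + g 1 1 ≠ 0) :
    mobius g y - mobius g x = (y - x) / ((g 1 0 * x + g 1 1) * (g 1 0 * y + g 1 1)) := by
  unfold mobius
  rw [div_sub_div _ _ hy hx, div_eq_div_iff (mul_ne_zero hy hx) (mul_ne_zero hx hy)]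
  linear_combination ((g 1 0 * x + g 1 1) * (g 1 0 * y + g 1 1)) * (y - x) * det_eq g

theorem measurable_mobius (g : SL2) : Measurable (mobius g) := by
  unfold mobius; fun_prop

theorem measurable_mobiusDerivB (g : SL2) : Measurable (mobiusDerivB g) := by
  have := measurable_mobius g
  unfold mobiusDerivB mobiusDeriv; fun_prop

theorem image_mobius_Icc (g : SL2) (s t : ℝ) (hst : s < t)
    (hpos : ∀ x ∈ Icc s t, ∀ y ∈ Icc s t, 0 < (g 1 0 * x + g 1 1) * (g 1 0 * y + g 1 1)) :
    mobius g '' Icc s t = Icc (mobius g s) (mobius g t) := by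
  have hne : ∀ x ∈ Icc s t, g 1 0 * x + g 1 1 ≠ 0 := fun x hx h => by
    have := hpos x hx x hx
    simp [h] at this
  apply ContinuousOn.image_Icc_of_monotoneOn hst.le
  · unfold mobius
    exact ContinuousOn.div (by fun_prop) (by fun_prop) hne
  · intro x hx y hy hxy
    have := mobius_sub g x y (hne x hx) (hne y hy)
    have h2 : 0 ≤ (y - x) / ((g 1 0 * x + g 1 1) * (g 1 0 * y + g 1 1)) :=
      div_nonneg (by linarith) (hpos x hx y hy).le
    linarith

/-- The integral formula for the measure of the image of an interval. -/
theorem conformal_formula {r : ℕ} (S : SchottkyData r) (δ : ℝ) (hδ0 : 0 < δ)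
    (μ : Measure ℝ) (hμ : S.IsPS δ μ) (g : SL2) (hg : g ∈ Subgroup.closure (Set.range S.γ))
    (s t : ℝ) (hst : s < t)
    (hpos : ∀ x ∈ Icc s t, ∀ y ∈ Icc s t, 0 < (g 1 0 * x + g 1 1) * (g 1 0 * y + g 1 1)) :
    (μ (mobius g '' Icc s t)).toReal = ∫ x in Icc s t, mobiusDerivB g x ^ δ ∂μ := by
  have hne : ∀ x ∈ Icc s t, g 1 0 * x + g 1 1 ≠ 0 := fun x hx h => by
    have := hpos x hx x hx
    simp [h] at this
  have hmeas : MeasurableSet (mobius g '' Icc s t) := by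
    rw [image_mobius_Icc g s t hst hpos]; exact measurableSet_Icc
  have h := hμ.2.2 g hg ((mobius g '' Icc s t).indicator 1)
    (measurable_one.indicator hmeas) ⟨1, fun x => by
      by_cases hx : x ∈ mobius g '' Icc s t <;> simp [hx]⟩
  rw [integral_indicator_one hmeas] at h
  rw [← integral_indicator measurableSet_Icc]
  refine Eq.trans h (integral_congr_ae (Filter.Eventually.of_forall fun x => ?_))
  simp only
  by_cases hx : x ∈ Icc s t
  · rw [indicator_of_mem hx, indicator_of_mem (mem_image_of_mem _ hx)]
    simp
  · rw [indicator_of_notMem hx]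
    by_cases hp : g 1 0 * x + g 1 1 = 0
    · simp [mobiusDerivB, mobiusDeriv, hp, Real.zero_rpow hδ0.ne']
    · rw [indicator_of_notMem, zero_mul]
      rintro ⟨y, hy, hyx⟩
      have h1 := mobius_sub g x y hp (hne y hy)
      rw [hyx, sub_self, eq_comm, div_eq_zero_iff] at h1
      rcases h1 with h1 | h1
      · exact hx (by rwa [← sub_eq_zero.mp h1])
      · exact mul_ne_zero hp (hne y hy) h1

/-- Core estimate. -/
theorem core_estimate {r : ℕ} (S : SchottkyData r) (δ : ℝ) (hδ0 : 0 < δ)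
    (μ : Measure ℝ) (hμ : S.IsPS δ μ) (g : SL2) (hg : g ∈ Subgroup.closure (Set.range S.γ))
    (s t : ℝ) (hst : s < t)
    (hpos : ∀ x ∈ Icc s t, ∀ y ∈ Icc s t, 0 < (g 1 0 * x + g 1 1) * (g 1 0 * y + g 1 1))
    (D R e : ℝ) (hD : 0 < D) (he : 0 < e) (hR0 : 0 < R)
    (hdist : ∀ x ∈ Icc s t, ∀ y ∈ Icc s t, (g 1 0 * x + g 1 1) ^ 2 ≤ D * (g 1 0 * y + g 1 1) ^ 2)
    (hR : ∀ x ∈ Icc s t, |x| ≤ R ∧ |mobius g x| ≤ R) (hlen : e ≤ t - s) :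
    let L := ivlen (mobius g '' Icc s t)
    0 < L ∧
    (((1 + R ^ 2) * D * (2 * R))⁻¹ * L) ^ δ * (μ (Icc s t)).toReal
        ≤ (μ (mobius g '' Icc s t)).toReal ∧
    (μ (mobius g '' Icc s t)).toReal
        ≤ (((1 + R ^ 2) * D * e⁻¹) * L) ^ δ * (μ (Icc s t)).toReal := by
  intro L
  have hprob := hμ.1
  have hs : s ∈ Icc s t := ⟨le_rfl, hst.le⟩
  have ht : t ∈ Icc s t := ⟨hst.le, le_rfl⟩
  have hne : ∀ x ∈ Icc s t, g 1 0 * x + g 1 1 ≠ 0 := fun x hx h => by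
    have := hpos x hx x hx
    simp [h] at this
  have hLeq : L = (t - s) / ((g 1 0 * s + g 1 1) * (g 1 0 * t + g 1 1)) := by
    rw [← mobius_sub g s t (hne s hs) (hne t ht)]
    have h0 : 0 ≤ mobius g t - mobius g s := by
      rw [mobius_sub g s t (hne s hs) (hne t ht)]
      exact div_nonneg (by linarith) (hpos s hs t ht).le
    simp only [L, ivlen]
    rw [image_mobius_Icc g s t hst hpos, Real.volume_Icc, ENNReal.toReal_ofReal h0]
  have hQ := hpos s hs t ht
  set Q := (g 1 0 * s + g 1 1) * (g 1 0 * t + g 1 1) with hQdef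
  have hLpos : 0 < L := by rw [hLeq]; exact div_pos (by linarith) hQ
  have hts : t - s ≤ 2 * R := by
    have h1 := abs_le.mp (hR s hs).1
    have h2 := abs_le.mp (hR t ht).1
    linarith
  have hB : ∀ x ∈ Icc s t, ((1 + R ^ 2) * D * (2 * R))⁻¹ * L ≤ mobiusDerivB g x ∧
      mobiusDerivB g x ≤ ((1 + R ^ 2) * D * e⁻¹) * L := by
    intro x hx
    have hx2 : x ^ 2 ≤ R ^ 2 := sq_le_sq' (abs_le.mp (hR x hx).1).1 (abs_le.mp (hR x hx).1).2
    have hgx2 : mobius g x ^ 2 ≤ R ^ 2 :=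
      sq_le_sq' (abs_le.mp (hR x hx).2).1 (abs_le.mp (hR x hx).2).2
    have hq : 0 < (g 1 0 * x + g 1 1) ^ 2 := by have := hne x hx; positivity
    have e1 := hdist s hs x hx
    have e2 := hdist t ht x hx
    have e3 := hdist x hx s hs
    have e4 := hdist x hx t ht
    set q := (g 1 0 * x + g 1 1) ^ 2 with hqdef
    have hQ1 : Q ≤ D * q := by
      refine (sq_le_sq₀ (by positivity) (by positivity)).mp ?_
      calc Q ^ 2 = (g 1 0 * s + g 1 1) ^ 2 * (g 1 0 * t + g 1 1) ^ 2 := by rw [hQdef]; ring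
        _ ≤ (D * q) * (D * q) := by gcongr
        _ = (D * q) ^ 2 := by ring
    have hQ2 : q ≤ D * Q := by
      refine (sq_le_sq₀ (by positivity) (by positivity)).mp ?_
      calc q ^ 2 = q * q := by ring
        _ ≤ (D * (g 1 0 * s + g 1 1) ^ 2) * (D * (g 1 0 * t + g 1 1) ^ 2) := by gcongr
        _ = (D * Q) ^ 2 := by rw [hQdef]; ring
    have hA1 : (1 + x ^ 2) / (1 + mobius g x ^ 2) ≤ 1 + R ^ 2 := by
      rw [div_le_iff₀ (by positivity)]
      nlinarith [sq_nonneg (mobius g x), mul_nonneg (sq_nonneg R) (sq_nonneg (mobius g x))]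
    have hA2 : (1 + R ^ 2)⁻¹ ≤ (1 + x ^ 2) / (1 + mobius g x ^ 2) := by
      rw [inv_le_comm₀ (by positivity) (by positivity), inv_div,
        div_le_iff₀ (by positivity)]
      nlinarith [sq_nonneg x, mul_nonneg (sq_nonneg R) (sq_nonneg x)]
    have hq1 : q⁻¹ ≤ D * e⁻¹ * L := by
      rw [hLeq]
      calc q⁻¹ ≤ D * Q⁻¹ := by
            rw [inv_le_iff_one_le_mul₀ hq]
            rw [← div_eq_mul_inv, div_mul_eq_mul_div, le_div_iff₀ hQ]; linarith
        _ = D * e⁻¹ * (e / Q) := by field_simp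
        _ ≤ D * e⁻¹ * ((t - s) / Q) := by gcongr
    have hq2 : (D * (2 * R))⁻¹ * L ≤ q⁻¹ := by
      rw [hLeq]
      calc (D * (2 * R))⁻¹ * ((t - s) / Q) ≤ (D * (2 * R))⁻¹ * ((2 * R) / Q) := by gcongr
        _ = (D * Q)⁻¹ := by field_simp
        _ ≤ q⁻¹ := inv_anti₀ hq hQ2
    unfold mobiusDerivB mobiusDeriv
    rw [← hqdef]
    constructor
    · calc ((1 + R ^ 2) * D * (2 * R))⁻¹ * L = (1 + R ^ 2)⁻¹ * ((D * (2 * R))⁻¹ * L) := by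
            rw [mul_assoc, mul_inv]; ring
        _ ≤ _ := by gcongr
    · calc _ ≤ (1 + R ^ 2) * (D * e⁻¹ * L) := by gcongr
        _ = _ := by ring
  have hlow0 : 0 ≤ ((1 + R ^ 2) * D * (2 * R))⁻¹ * L := by positivity
  have hBint : IntegrableOn (fun x => mobiusDerivB g x ^ δ) (Icc s t) μ := by
    apply Measure.integrableOn_of_bounded (M := (((1 + R ^ 2) * D * e⁻¹) * L) ^ δ)
      (measure_ne_top μ _)
    · refine (ae_restrict_iff' measurableSet_Icc).mpr (Filter.Eventually.of_forall fun x hx => ?_)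
      have h0 := hlow0.trans (hB x hx).1
      rw [Real.norm_of_nonneg (Real.rpow_nonneg h0 _)]
      exact Real.rpow_le_rpow h0 (hB x hx).2 hδ0.le
    · exact ((measurable_mobiusDerivB g).pow_const δ).aestronglyMeasurable
  refine ⟨hLpos, ?_, ?_⟩ <;> rw [conformal_formula S δ hδ0 μ hμ g hg s t hst hpos]
  · calc _ = ∫ x in Icc s t, (((1 + R ^ 2) * D * (2 * R))⁻¹ * L) ^ δ ∂μ := by
          rw [setIntegral_const, smul_eq_mul, mul_comm]; rfl
      _ ≤ _ := setIntegral_mono_on (integrableOn_const (measure_ne_top μ _)) hBint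
          measurableSet_Icc fun x hx => Real.rpow_le_rpow hlow0 (hB x hx).1 hδ0.le
  · calc _ ≤ ∫ x in Icc s t, (((1 + R ^ 2) * D * e⁻¹) * L) ^ δ ∂μ :=
          setIntegral_mono_on hBint (integrableOn_const (measure_ne_top μ _))
          measurableSet_Icc fun x hx =>
            Real.rpow_le_rpow (hlow0.trans (hB x hx).1) (hB x hx).2 hδ0.le
      _ = _ := by
          rw [setIntegral_const, smul_eq_mul, mul_comm]; rfl

theorem word_maps {r : ℕ} (S : SchottkyData r) (b : Fin (2 * r)) (x : OnePoint ℝ) :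
    ∀ (w : List (Fin (2 * r))) (hw : w ≠ []), S.IsWord w → 
      x ∉ (fun t : ℝ => (t : OnePoint ℝ)) '' Ioo (S.ξ₀ (bar (w.getLast hw)))
        (S.ξ₁ (bar (w.getLast hw))) →
      mobiusOP (S.wordγ w) x ∈
        (fun t : ℝ => (t : OnePoint ℝ)) '' Icc (S.ξ₀ (w.head hw)) (S.ξ₁ (w.head hw)) := by
  intro w
  induction w with
  | nil => intro hw; exact absurd rfl hw
  | cons a w ih =>
    intro _ hword hx
    rcases w with _ | ⟨c, w⟩
    · simp only [SchottkyData.wordγ, List.map_cons, List.map_nil, List.prod_cons, List.prod_nil,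
        mul_one, List.head_cons]
      rw [← S.hmap a]
      exact mem_image_of_mem _ ⟨mem_univ _, hx⟩
    · have hword' : List.IsChain (fun p q => q ≠ bar p) (a :: c :: w) := hword
      rw [List.isChain_cons_cons] at hword'
      have h := ih (by simp) hword'.2 (by simpa using hx)
      have hγ : S.wordγ (a :: c :: w) = S.γ a * S.wordγ (c :: w) := by
        simp [SchottkyData.wordγ]
      rw [hγ, mobiusOP_mul, List.head_cons, ← S.hmap a]
      refine mem_image_of_mem _ ⟨mem_univ _, ?_⟩
      obtain ⟨y, hy, hyx⟩ := h
      rintro ⟨z, hz, hzx⟩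
      have : z = y := OnePoint.coe_injective (hzx.trans hyx.symm)
      subst this
      exact Set.disjoint_left.mp (S.hdisj _ _ hword'.1) hy (Ioo_subset_Icc_self hz)

theorem wordγ_mem {r : ℕ} (S : SchottkyData r) (w : List (Fin (2 * r))) :
    S.wordγ w ∈ Subgroup.closure (Set.range S.γ) := by
  apply Subgroup.list_prod_mem
  intro x hx
  obtain ⟨a, -, rfl⟩ := List.mem_map.mp hx
  exact Subgroup.subset_closure ⟨a, rfl⟩

theorem bar_bar {r : ℕ} (a : Fin (2 * r)) : bar (bar a) = a := by
  have := a.isLt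
  by_cases h : (a : ℕ) < r
  · have h1 : bar a = ⟨(a : ℕ) + r, by omega⟩ := by simp [bar, h]
    rw [h1]
    ext
    simp [bar]
  · have h1 : bar a = ⟨(a : ℕ) - r, by omega⟩ := by simp [bar, h]
    rw [h1]
    have h2 : (a : ℕ) - r < r := by omega
    ext
    simp [bar, h2]
    omega

/-- Uniform constants. -/
theorem schottky_constants {r : ℕ} (S : SchottkyData r) : ∃ R > 0, ∃ e > 0, ∃ d > 0,
    (∀ a, ∀ x ∈ Icc (S.ξ₀ a) (S.ξ₁ a), |x| ≤ R) ∧ (∀ a, e ≤ S.ξ₁ a - S.ξ₀ a) ∧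
    (∀ a b, a ≠ b → ∀ x ∈ Icc (S.ξ₀ a) (S.ξ₁ a), ∀ y ∈ Icc (S.ξ₀ b) (S.ξ₁ b), d ≤ |x - y|) ∧
    d ≤ R := by
  obtain ⟨R, hR⟩ := Finite.bddAbove_range (fun a => |S.ξ₀ a| + |S.ξ₁ a|)
  obtain ⟨e, he, hE⟩ := exists_pos_le_all (fun a => S.ξ₁ a - S.ξ₀ a)
    (fun a => sub_pos.mpr (S.hlt a))
  have hex : ∀ p : Fin (2 * r) × Fin (2 * r), ∃ d > 0, p.1 ≠ p.2 →
      ∀ x ∈ Icc (S.ξ₀ p.1) (S.ξ₁ p.1), ∀ y ∈ Icc (S.ξ₀ p.2) (S.ξ₁ p.2), d ≤ |x - y| := by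
    rintro ⟨a, b⟩
    by_cases hab : a = b
    · exact ⟨1, one_pos, fun h => absurd hab h⟩
    · have hdj := Set.disjoint_left.mp (S.hdisj a b hab)
      have ha := S.hlt a
      have hb := S.hlt b
      rcases lt_or_ge (S.ξ₁ a) (S.ξ₀ b) with h | h
      · refine ⟨S.ξ₀ b - S.ξ₁ a, by linarith, fun _ x hx y hy => ?_⟩
        rw [abs_sub_comm]
        exact le_trans (by linarith [hx.2, hy.1]) (le_abs_self _)
      · rcases lt_or_ge (S.ξ₁ b) (S.ξ₀ a) with h' | h'
        · refine ⟨S.ξ₀ a - S.ξ₁ b, by linarith, fun _ x hx y hy => ?_⟩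
          exact le_trans (by linarith [hx.1, hy.2]) (le_abs_self _)
        · exfalso
          rcases le_total (S.ξ₀ a) (S.ξ₀ b) with h2 | h2
          · exact hdj ⟨h2, h⟩ ⟨le_rfl, hb.le⟩
          · exact hdj ⟨le_rfl, ha.le⟩ ⟨h2, h'⟩
  choose f hf hf' using hex
  obtain ⟨d, hd, hD⟩ := exists_pos_le_all f hf
  refine ⟨max R d, lt_max_of_lt_right hd, e, he, d, hd, ?_, hE, ?_, le_max_right _ _⟩
  · intro a x hx
    have h1 : |S.ξ₀ a| + |S.ξ₁ a| ≤ R := hR ⟨a, rfl⟩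
    refine le_trans (abs_le.mpr ⟨?_, ?_⟩) (h1.trans (le_max_left _ _))
    · linarith [hx.1, neg_abs_le (S.ξ₀ a), abs_nonneg (S.ξ₁ a)]
    · linarith [hx.2, le_abs_self (S.ξ₁ a), abs_nonneg (S.ξ₀ a)]
  · intro a b hab x hx y hy
    exact (hD (a, b)).trans (hf' (a, b) hab x hx y hy)

/-- Geometry of `γ_w` on `I_b` for a word `wb`. -/
theorem word_geometry {r : ℕ} (S : SchottkyData r) (R d : ℝ) (hd : 0 < d) (hdR : d ≤ R)
    (hR : ∀ a, ∀ x ∈ Icc (S.ξ₀ a) (S.ξ₁ a), |x| ≤ R)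
    (hsep : ∀ a b, a ≠ b → ∀ x ∈ Icc (S.ξ₀ a) (S.ξ₁ a), ∀ y ∈ Icc (S.ξ₀ b) (S.ξ₁ b),
      d ≤ |x - y|)
    (w : List (Fin (2 * r))) (b : Fin (2 * r)) (hw : S.IsWord (w ++ [b])) :
    (∀ x ∈ Icc (S.ξ₀ b) (S.ξ₁ b), ∀ y ∈ Icc (S.ξ₀ b) (S.ξ₁ b),
      0 < (S.wordγ w 1 0 * x + S.wordγ w 1 1) * (S.wordγ w 1 0 * y + S.wordγ w 1 1)) ∧
    (∀ x ∈ Icc (S.ξ₀ b) (S.ξ₁ b), ∀ y ∈ Icc (S.ξ₀ b) (S.ξ₁ b),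
      (S.wordγ w 1 0 * x + S.wordγ w 1 1) ^ 2 ≤
        (2 * R / d) ^ 2 * (S.wordγ w 1 0 * y + S.wordγ w 1 1) ^ 2) ∧
    (∀ x ∈ Icc (S.ξ₀ b) (S.ξ₁ b), ∃ a, (w ++ [b]).head (by simp) = a ∧
      mobius (S.wordγ w) x ∈ Icc (S.ξ₀ a) (S.ξ₁ a)) := by
  rcases eq_or_ne w [] with rfl | hne
  · have h1 : S.wordγ [] = 1 := rfl
    have hge : 1 ≤ (2 * R / d) ^ 2 := by
      apply one_le_pow₀
      rw [le_div_iff₀ hd]; linarith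
    rw [h1]
    refine ⟨by simp, by simpa using fun _ _ _ _ _ _ => hge, ?_⟩
    intro x hx
    refine ⟨b, by simp, ?_⟩
    simpa [mobius] using hx
  · have hch : List.IsChain (fun p q => q ≠ bar p) (w ++ [b]) := hw
    rw [List.isChain_append] at hch
    obtain ⟨hch1, -, hch2⟩ := hch
    have hb : b ≠ bar (w.getLast hne) :=
      hch2 _ (List.getLast_mem_getLast? hne) b (by simp)
    have hmaps := fun x => word_maps S b x w hne hch1
    set g := S.wordγ w with hg
    have hc : g 1 0 ≠ 0 := by
      intro hc
      obtain ⟨y, -, hy⟩ := hmaps OnePoint.infty (by rintro ⟨t, -, ht⟩; exact OnePoint.coe_ne_infty t ht)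
      rw [mobiusOP_infty, if_pos hc] at hy
      exact OnePoint.coe_ne_infty y hy
    set p := -(g 1 1) / g 1 0 with hp
    have hpeq : ∀ x, g 1 0 * x + g 1 1 = g 1 0 * (x - p) := by
      intro x; rw [hp]; field_simp; ring
    have hpI : p ∈ Ioo (S.ξ₀ (bar (w.getLast hne))) (S.ξ₁ (bar (w.getLast hne))) := by
      by_contra hcon
      obtain ⟨y, -, hy⟩ := hmaps (p : OnePoint ℝ) (by
        rintro ⟨t, ht, htp⟩
        exact hcon (OnePoint.coe_injective htp ▸ ht))
      rw [mobiusOP_coe, if_pos (by rw [hpeq]; simp)] at hy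
      exact OnePoint.coe_ne_infty y hy
    have hpI' := Ioo_subset_Icc_self hpI
    have hdist : ∀ x ∈ Icc (S.ξ₀ b) (S.ξ₁ b), d ≤ |x - p| ∧ |x - p| ≤ 2 * R := by
      intro x hx
      refine ⟨hsep b _ hb x hx p hpI', ?_⟩
      have := abs_sub x p
      linarith [hR b x hx, hR _ p hpI']
    refine ⟨?_, ?_, ?_⟩
    · intro x hx y hy
      rw [hpeq, hpeq]
      have hpnot : p ∉ Icc (S.ξ₀ b) (S.ξ₁ b) := fun h =>
        Set.disjoint_left.mp (S.hdisj _ _ hb) h hpI'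
      have : 0 < (x - p) * (y - p) := by
        rcases lt_or_ge p (S.ξ₀ b) with h | h
        · exact mul_pos (by linarith [hx.1]) (by linarith [hy.1])
        · have h3 : S.ξ₁ b < p := by
            by_contra h4
            exact hpnot ⟨h, not_lt.mp h4⟩
          exact mul_pos_of_neg_of_neg (by linarith [hx.2]) (by linarith [hy.2])
      have h2 : 0 < g 1 0 ^ 2 := by positivity
      nlinarith [mul_pos h2 this]
    · intro x hx y hy
      rw [hpeq, hpeq, ← mul_pow, sq_le_sq, abs_mul, abs_mul, abs_mul]
      have hRd : 0 ≤ 2 * R / d := div_nonneg (by linarith) hd.le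
      rw [abs_of_nonneg hRd]
      have h1 : |x - p| ≤ 2 * R / d * |y - p| := by
        rw [div_mul_eq_mul_div, le_div_iff₀ hd]
        exact mul_le_mul (hdist x hx).2 (hdist y hy).1 hd.le (by linarith)
      nlinarith [mul_le_mul_of_nonneg_left h1 (abs_nonneg (g 1 0))]
    · intro x hx
      obtain ⟨y, hy, hyx⟩ := hmaps (x : OnePoint ℝ) (by
        rintro ⟨t, ht, htp⟩
        have := OnePoint.coe_injective htp
        subst this
        exact Set.disjoint_left.mp (S.hdisj _ _ hb) hx (Ioo_subset_Icc_self ht))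
      refine ⟨w.head hne, by rw [List.head_append_of_ne_nil], ?_⟩
      rw [mobiusOP_coe] at hyx
      split_ifs at hyx with h0
      · exact absurd hyx (OnePoint.coe_ne_infty y)
      · rw [← OnePoint.coe_injective hyx]; exact hy

theorem wordI_append {r : ℕ} (S : SchottkyData r) (w : List (Fin (2 * r))) (b : Fin (2 * r)) :
    S.wordI (w ++ [b]) = mobius (S.wordγ w) '' Icc (S.ξ₀ b) (S.ξ₁ b) := by
  simp [SchottkyData.wordI]

theorem word_estimate {r : ℕ} (S : SchottkyData r) (δ : ℝ) (hδ0 : 0 < δ)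
    (μ : Measure ℝ) (hμ : S.IsPS δ μ) : ∃ K₁ > 0, ∃ K₂ > 0,
    ∀ (w : List (Fin (2 * r))) (b : Fin (2 * r)), S.IsWord (w ++ [b]) →
      0 < ivlen (S.wordI (w ++ [b])) ∧
      (K₁ * ivlen (S.wordI (w ++ [b]))) ^ δ * (μ (Icc (S.ξ₀ b) (S.ξ₁ b))).toReal
        ≤ (μ (S.wordI (w ++ [b]))).toReal ∧
      (μ (S.wordI (w ++ [b]))).toReal ≤
        (K₂ * ivlen (S.wordI (w ++ [b]))) ^ δ * (μ (Icc (S.ξ₀ b) (S.ξ₁ b))).toReal := by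
  obtain ⟨R, hR0, e, he, d, hd, hR, hlen, hsep, hdR⟩ := schottky_constants S
  refine ⟨((1 + R ^ 2) * (2 * R / d) ^ 2 * (2 * R))⁻¹, by positivity,
    (1 + R ^ 2) * (2 * R / d) ^ 2 * e⁻¹, by positivity, fun w b hw => ?_⟩
  obtain ⟨h1, h2, h3⟩ := word_geometry S R d hd hdR hR hsep w b hw
  rw [wordI_append]
  refine core_estimate S δ hδ0 μ hμ (S.wordγ w) (wordγ_mem S w) _ _ (S.hlt b) h1 _ R e
    (by positivity) he hR0 h2 (fun x hx => ⟨hR b x hx, ?_⟩) (hlen b)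
  obtain ⟨a, -, ha⟩ := h3 x hx
  exact hR a _ ha

theorem letter_pos {r : ℕ} (S : SchottkyData r) (δ : ℝ) (hδ0 : 0 < δ)
    (μ : Measure ℝ) (hμ : S.IsPS δ μ) (b : Fin (2 * r)) :
    0 < (μ (Icc (S.ξ₀ b) (S.ξ₁ b))).toReal := by
  have hprob := hμ.1
  obtain ⟨R, hR0, e, he, d, hd, hR, hlen, hsep, hdR⟩ := schottky_constants S
  obtain ⟨K₁, hK₁, K₂, hK₂, hest⟩ := word_estimate S δ hδ0 μ hμ
  have step : ∀ a b, b ≠ bar a → 0 < (μ (Icc (S.ξ₀ a) (S.ξ₁ a))).toReal →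
      0 < (μ (Icc (S.ξ₀ b) (S.ξ₁ b))).toReal := by
    intro a b hab ha
    have hw : S.IsWord ([b] ++ [a]) := by
      show List.IsChain (fun p q => q ≠ bar p) [b, a]
      simp only [List.isChain_cons_cons, List.isChain_singleton, and_true]
      intro h
      exact hab (by rw [h, bar_bar])
    obtain ⟨h1, h2, -⟩ := hest [b] a hw
    have h3 : 0 < (μ (S.wordI ([b] ++ [a]))).toReal :=
      lt_of_lt_of_le (mul_pos (Real.rpow_pos_of_pos (mul_pos hK₁ h1) _) ha) h2
    refine lt_of_lt_of_le h3 (ENNReal.toReal_mono (measure_ne_top μ _) (measure_mono ?_))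
    rw [wordI_append]
    rintro _ ⟨x, hx, rfl⟩
    obtain ⟨c, hc, hcx⟩ := (word_geometry S R d hd hdR hR hsep [b] a hw).2.2 x hx
    have : c = b := by rw [← hc]; rfl
    rwa [this] at hcx
  obtain ⟨a, ha⟩ : ∃ a, 0 < (μ (Icc (S.ξ₀ a) (S.ξ₁ a))).toReal := by
    by_contra hcon
    push Not at hcon
    have hz : ∀ a, μ (Icc (S.ξ₀ a) (S.ξ₁ a)) = 0 := by
      intro a
      have := le_antisymm (hcon a) ENNReal.toReal_nonneg
      exact (ENNReal.toReal_eq_zero_iff _).mp this |>.resolve_right (measure_ne_top μ _)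
    have hU : μ (⋃ a, Icc (S.ξ₀ a) (S.ξ₁ a)) = 0 := measure_iUnion_null hz
    have hsub : (univ : Set ℝ) ⊆ S.limitSetᶜ ∪ ⋃ a, Icc (S.ξ₀ a) (S.ξ₁ a) := by
      intro x _
      by_cases hx : x ∈ S.limitSet
      · right
        have h0 := Set.mem_iInter.mp hx 0
        simp only [Set.mem_iUnion] at h0
        obtain ⟨l, ⟨-, hl⟩, hxl⟩ := h0
        obtain ⟨a, rfl⟩ := List.length_eq_one_iff.mp (by simpa using hl)
        refine Set.mem_iUnion.mpr ⟨a, ?_⟩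
        have h4 := wordI_append S [] a
        rw [List.nil_append] at h4
        rw [h4] at hxl
        obtain ⟨y, hy, rfl⟩ := hxl
        have h1 : S.wordγ [] = 1 := rfl
        simpa [h1, mobius] using hy
      · exact Or.inl hx
    have h1 := measure_mono_null hsub (measure_union_null hμ.2.1 hU)
    simp at h1
  by_cases hb : b = bar a
  · have hr := S.hr
    obtain ⟨c, hc1, hc2⟩ : ∃ c : Fin (2 * r), c ≠ a ∧ c ≠ bar a := by
      have hcard : ({a, bar a} : Finset (Fin (2 * r))).card < Fintype.card (Fin (2 * r)) := by
        refine lt_of_le_of_lt Finset.card_le_two ?_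
        rw [Fintype.card_fin]; omega
      obtain ⟨c, hc⟩ := Finset.exists_mem_notMem_of_card_lt_card
        (s := {a, bar a}) (t := Finset.univ) (by simpa using hcard)
      simp at hc
      exact ⟨c, hc.1, hc.2⟩
    refine step c b ?_ (step a c hc2 ha)
    rw [hb]
    intro h
    apply hc1
    rw [← bar_bar c, ← h, bar_bar]
  · exact step a b hb ha

/-- **Patterson–Sullivan measure of the intervals `I_𝐚`:** there is `C_Γ > 0` depending only
on the Schottky data such that `C_Γ⁻¹|I_𝐚|^δ ≤ μ(I_𝐚) ≤ C_Γ|I_𝐚|^δ` for every nonempty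
word `𝐚`. -/
theorem measure_of_word_interval (r : ℕ) (S : SchottkyData r) (δ : ℝ)
    (hδ0 : 0 < δ) (hδ1 : δ < 1) (μ : Measure ℝ) (hμ : S.IsPS δ μ) :
    ∃ C > (0 : ℝ), ∀ l : List (Fin (2 * r)), l ≠ [] → S.IsWord l →
      C⁻¹ * ivlen (S.wordI l) ^ δ ≤ (μ (S.wordI l)).toReal ∧
      (μ (S.wordI l)).toReal ≤ C * ivlen (S.wordI l) ^ δ := by
  obtain ⟨K₁, hK₁, K₂, hK₂, hest⟩ := word_estimate S δ hδ0 μ hμ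
  obtain ⟨m, hm, hmb⟩ := exists_pos_le_all _ (letter_pos S δ hδ0 μ hμ)
  have hprob := hμ.1
  have hA : 0 < K₁ ^ δ * m := mul_pos (Real.rpow_pos_of_pos hK₁ _) hm
  have hB : 0 < K₂ ^ δ := Real.rpow_pos_of_pos hK₂ _
  refine ⟨max (K₁ ^ δ * m)⁻¹ (K₂ ^ δ), lt_max_of_lt_right hB, fun l hl hword => ?_⟩
  obtain ⟨w, b, rfl⟩ : ∃ w b, l = w ++ [b] :=
    ⟨l.dropLast, l.getLast hl, (List.dropLast_append_getLast hl).symm⟩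
  obtain ⟨h1, h2, h3⟩ := hest w b hword
  rw [Real.mul_rpow hK₁.le h1.le] at h2
  rw [Real.mul_rpow hK₂.le h1.le] at h3
  have hL := Real.rpow_pos_of_pos h1 δ
  have hle : (μ (Icc (S.ξ₀ b) (S.ξ₁ b))).toReal ≤ 1 := by
    have := prob_le_one (μ := μ) (s := Icc (S.ξ₀ b) (S.ξ₁ b))
    simpa using ENNReal.toReal_mono ENNReal.one_ne_top this
  constructor
  · refine le_trans ?_ h2
    have h4 : (max (K₁ ^ δ * m)⁻¹ (K₂ ^ δ))⁻¹ ≤ K₁ ^ δ * m :=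
      inv_le_of_inv_le₀ hA (le_max_left _ _)
    calc _ ≤ (K₁ ^ δ * m) * ivlen (S.wordI (w ++ [b])) ^ δ :=
          mul_le_mul_of_nonneg_right h4 hL.le
      _ = K₁ ^ δ * ivlen (S.wordI (w ++ [b])) ^ δ * m := by ring
      _ ≤ _ := mul_le_mul_of_nonneg_left (hmb b)
          (mul_pos (Real.rpow_pos_of_pos hK₁ _) hL).le
  · refine h3.trans ?_
    calc _ ≤ K₂ ^ δ * ivlen (S.wordI (w ++ [b])) ^ δ * 1 :=
          mul_le_mul_of_nonneg_left hle (mul_pos hB hL).le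
      _ ≤ _ := by
          rw [mul_one]
          exact mul_le_mul_of_nonneg_right (le_max_right _ _) hL.le

end
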